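/- arXiv:2505.01229 — 2 statements merged into one kernel-verified Lean document; each statement's English description precedes it below -/
import Mathlib

section
/- Let K be a proper cone, c a unit vector in the interior of K ∩ K^*, E_t = c c^T + t(I − c c^T), and define the cone-norm ‖x‖_K = inf{t > 0 : x ∈ E_t K} for x with (x,c) > 0. Then ‖x‖_K = 0 if and only if x = λc for some λ ≥ 0. -/
open Matrix Set

def IsProperCone {d : ℕ} (K : Set (Fin d → ℝ)) : Prop :=
  IsClosed K ∧ Convex ℝ K ∧ (∀ x ∈ K, ∀ t : ℝ, 0 ≤ t → t • x ∈ K) ∧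
    K ∩ (-K) = {0} ∧ (interior K).Nonempty

def dualConeSet {d : ℕ} (K : Set (Fin d → ℝ)) : Set (Fin d → ℝ) :=
  {x | ∀ y ∈ K, 0 ≤ x ⬝ᵥ y}

noncomputable def Emat {d : ℕ} (c : Fin d → ℝ) (t : ℝ) : Matrix (Fin d) (Fin d) ℝ :=
  vecMulVec c c + t • (1 - vecMulVec c c)

/-- The cone-norm `‖x‖_K = inf {t > 0 : x ∈ E_t K}`. -/
noncomputable def coneNorm {d : ℕ} (K : Set (Fin d → ℝ)) (c : Fin d → ℝ)
    (x : Fin d → ℝ) : ℝ :=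
  sInf {t : ℝ | 0 < t ∧ x ∈ (Emat c t).mulVec '' K}

theorem Emat_mulVec {d : ℕ} (c : Fin d → ℝ) (t : ℝ) (y : Fin d → ℝ) :
    (Emat c t).mulVec y = (c ⬝ᵥ y) • c + t • (y - (c ⬝ᵥ y) • c) := by
  simp [Emat, Matrix.add_mulVec, Matrix.smul_mulVec, Matrix.sub_mulVec, Matrix.vecMulVec_mulVec]

/-- Decomposing `x = (c ⬝ᵥ x) • c + w`, membership in the scaled cone `E_t K` is a condition on
the transverse part `w` alone. -/
theorem mem_Emat_image_iff {d : ℕ} {K : Set (Fin d → ℝ)} {c : Fin d → ℝ} (hc : c ⬝ᵥ c = 1)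
    {t : ℝ} (ht : 0 < t) (x : Fin d → ℝ) :
    x ∈ (Emat c t).mulVec '' K ↔ (c ⬝ᵥ x) • c + t⁻¹ • (x - (c ⬝ᵥ x) • c) ∈ K := by
  constructor
  · rintro ⟨y, hy, rfl⟩
    have hcy : c ⬝ᵥ (Emat c t).mulVec y = c ⬝ᵥ y := by
      simp [Emat_mulVec, dotProduct_add, dotProduct_sub, hc]
    rw [hcy, Emat_mulVec, add_sub_cancel_left, inv_smul_smul₀ ht.ne', add_sub_cancel]
    exact hy
  · intro h
    refine ⟨_, h, ?_⟩
    have hcy : c ⬝ᵥ ((c ⬝ᵥ x) • c + t⁻¹ • (x - (c ⬝ᵥ x) • c)) = c ⬝ᵥ x := by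
      simp [dotProduct_add, dotProduct_sub, hc]
    rw [Emat_mulVec, hcy, add_sub_cancel_left, smul_inv_smul₀ ht.ne', add_sub_cancel]

theorem exists_pos_add_sub_smul_mem {d : ℕ} {S : Set (Fin d → ℝ)} {c : Fin d → ℝ}
    (hS : c ∈ interior S) (w : Fin d → ℝ) :
    ∃ ε : ℝ, 0 < ε ∧ c + ε • w ∈ S ∧ c - ε • w ∈ S := by
  have hnear (v : Fin d → ℝ) : ∀ᶠ s : ℝ in nhdsWithin 0 (Ioi 0), c + s • v ∈ S := by
    have hcont : Continuous fun s : ℝ => c + s • v := by fun_prop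
    refine (hcont.tendsto 0).eventually ?_ |>.filter_mono nhdsWithin_le_nhds
    simpa using mem_interior_iff_mem_nhds.mp hS
  obtain ⟨ε, ⟨h₁, h₂⟩, hε⟩ :=
    (((hnear w).and (hnear (-w))).and self_mem_nhdsWithin).exists
  exact ⟨ε, hε, h₁, by simpa [sub_eq_add_neg] using h₂⟩

theorem coneNorm_eq_zero_iff {d : ℕ} (K : Set (Fin d → ℝ))
    (hK : IsProperCone K) (c : Fin d → ℝ) (hc : c ⬝ᵥ c = 1)
    (hcint : c ∈ interior (K ∩ dualConeSet K))
    (x : Fin d → ℝ) (hx : 0 < x ⬝ᵥ c) :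
    coneNorm K c x = 0 ↔ ∃ l : ℝ, 0 ≤ l ∧ x = l • c := by
  obtain ⟨-, -, hsmul, -, -⟩ := hK
  rw [dotProduct_comm] at hx
  have hcK : c ∈ K := (interior_subset hcint).1
  constructor
  · intro h
    set a := c ⬝ᵥ x with ha
    set w := x - a • c with hw
    have hcw : c ⬝ᵥ w = 0 := by simp [hw, dotProduct_sub, hc, ha]
    obtain ⟨ε, hε, hadd, hsub⟩ := exists_pos_add_sub_smul_mem hcint w
    have hne : {t : ℝ | 0 < t ∧ x ∈ (Emat c t).mulVec '' K}.Nonempty := by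
      refine ⟨(a * ε)⁻¹, by positivity, ?_⟩
      rw [mem_Emat_image_iff hc (by positivity), inv_inv, mul_smul, ← smul_add]
      exact hsmul _ hadd.1 _ hx.le
    have hlower : ε * (w ⬝ᵥ w) / a ≤ coneNorm K c x := by
      refine le_csInf hne ?_
      rintro t ⟨ht, hmem⟩
      rw [mem_Emat_image_iff hc ht] at hmem
      have hdual : 0 ≤ (c - ε • w) ⬝ᵥ (a • c + t⁻¹ • w) := hsub.2 _ hmem
      have hexp : (c - ε • w) ⬝ᵥ (a • c + t⁻¹ • w) = a - t⁻¹ * (ε * (w ⬝ᵥ w)) := by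
        simp only [sub_dotProduct, dotProduct_add, smul_dotProduct, dotProduct_smul, hc, hcw,
          dotProduct_comm w c, smul_eq_mul]
        ring
      rw [hexp, sub_nonneg, inv_mul_le_iff₀ ht] at hdual
      rwa [div_le_iff₀ hx]
    rw [h, div_le_iff₀ hx, zero_mul] at hlower
    have hww : w ⬝ᵥ w = 0 :=
      le_antisymm (nonpos_of_mul_nonpos_right hlower hε)
        (Finset.sum_nonneg fun i _ => mul_self_nonneg (w i))
    exact ⟨a, hx.le, sub_eq_zero.mp (dotProduct_self_eq_zero.mp hww)⟩
  · rintro ⟨l, hl, rfl⟩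
    have hset : {t : ℝ | 0 < t ∧ l • c ∈ (Emat c t).mulVec '' K} = Ioi 0 := by
      ext t
      refine and_iff_left_of_imp fun ht => (mem_Emat_image_iff hc ht _).mpr ?_
      simpa [hc] using hsmul c hcK l hl
    rw [coneNorm, hset, csInf_Ioi]
end

section
/- Let 𝒜 = {A₁,…,A_m} be an irreducible finite family of nonsingular d×d matrices possessing an invariant cone, and let the Direct Algorithm be started from a vector v ∈ K_min which is not an extreme vector of K_min. Then for every j, the cone K_j produced after j iterations (the conic hull of all images of v under products of matrices of 𝒜 of length at most j) contains no extreme generator of K_min; consequently K_j ≠ K_min and K_j is not invariant for 𝒜. -/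
open Matrix Set

def IsInvariantCone {d m : ℕ} (𝒜 : Fin m → Matrix (Fin d) (Fin d) ℝ)
    (K : Set (Fin d → ℝ)) : Prop :=
  IsProperCone K ∧ ∀ i, ∀ x ∈ K, (𝒜 i).mulVec x ∈ K

def IsIrreducibleFamily {d m : ℕ} (𝒜 : Fin m → Matrix (Fin d) (Fin d) ℝ) : Prop :=
  ∀ V : Submodule ℝ (Fin d → ℝ), (∀ i, ∀ x ∈ V, (𝒜 i).mulVec x ∈ V) → V = ⊥ ∨ V = ⊤

def IsMinimalInvariantCone {d m : ℕ} (𝒜 : Fin m → Matrix (Fin d) (Fin d) ℝ)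
    (K : Set (Fin d → ℝ)) : Prop :=
  IsInvariantCone 𝒜 K ∧ ∀ K' : Set (Fin d → ℝ), IsInvariantCone 𝒜 K' → K ⊆ K' ∨ K ⊆ -K'

/-- `v` is an extreme vector (generator of an extreme ray) of the cone `K`. -/
def IsExtremeVector {d : ℕ} (K : Set (Fin d → ℝ)) (v : Fin d → ℝ) : Prop :=
  v ≠ 0 ∧ v ∈ K ∧ ∀ u ∈ K, ∀ w ∈ K, v = u + w →
    (∃ t : ℝ, 0 ≤ t ∧ u = t • v) ∧ (∃ t : ℝ, 0 ≤ t ∧ w = t • v)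

/-- The cone produced after `j` iterations of the Direct Algorithm started at
`v`: the conic hull of all images of `v` under products of matrices of `𝒜` of
length at most `j`. -/
def directAlgCone {d m : ℕ} (𝒜 : Fin m → Matrix (Fin d) (Fin d) ℝ)
    (v : Fin d → ℝ) (j : ℕ) : Set (Fin d → ℝ) :=
  convexHull ℝ {x | ∃ l : List (Fin m), l.length ≤ j ∧
    ∃ t : ℝ, 0 ≤ t ∧ x = t • ((l.map 𝒜).prod.mulVec v)}

theorem IsExtremeVector.of_eq_smul {d : ℕ} {K : Set (Fin d → ℝ)}
    (hK : ∀ x ∈ K, ∀ t : ℝ, 0 ≤ t → t • x ∈ K) {x y : Fin d → ℝ} {t : ℝ} (ht : 0 ≤ t)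
    (hy : IsExtremeVector K y) (hx : x ∈ K) (hxy : y = t • x) : IsExtremeVector K x := by
  have ht0 : t ≠ 0 := fun h => hy.1 (by simp [hxy, h])
  refine ⟨fun h => hy.1 (by simp [hxy, h]), hx, fun u hu w hw huw => ?_⟩
  have key : ∀ {z : Fin d → ℝ}, (∃ s : ℝ, 0 ≤ s ∧ t • z = s • y) →
      ∃ s : ℝ, 0 ≤ s ∧ z = s • x := by
    rintro z ⟨s, hs, hz⟩
    refine ⟨s, hs, smul_right_injective _ ht0 ?_⟩
    simp only [hz, hxy, smul_comm s t]
  obtain ⟨h₁, h₂⟩ := hy.2.2 (t • u) (hK u hu t ht) (t • w) (hK w hw t ht)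
    (by rw [hxy, huw, smul_add])
  exact ⟨key h₁, key h₂⟩

theorem convex_setOf_not_isExtremeVector {d : ℕ} {K : Set (Fin d → ℝ)} (hconv : Convex ℝ K)
    (hK : ∀ x ∈ K, ∀ t : ℝ, 0 ≤ t → t • x ∈ K) :
    Convex ℝ {x ∈ K | ¬ IsExtremeVector K x} := by
  rintro x ⟨hx, hxe⟩ y ⟨hy, hye⟩ a b ha hb hab
  refine ⟨hconv hx hy ha hb hab, fun hext => ?_⟩
  have key : ∀ {z : Fin d → ℝ} {c s : ℝ}, z ∈ K → ¬ IsExtremeVector K z → 0 ≤ c → 0 ≤ s →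
      c • z = s • (a • x + b • y) → c • z = 0 := by
    intro z c s hz hze hc hs h
    rcases hs.eq_or_lt with rfl | hs
    · simpa using h
    · refine absurd (hext.of_eq_smul hK (t := s⁻¹ * c) (by positivity) hz ?_) hze
      rw [mul_smul, h, inv_smul_smul₀ hs.ne']
  obtain ⟨⟨s, hs, h₁⟩, t, ht, h₂⟩ := hext.2.2 _ (hK x hx a ha) _ (hK y hy b hb) rfl
  apply hext.1
  rw [key hx hxe ha hs h₁, key hy hye hb ht h₂, add_zero]

theorem not_isExtremeVector_mulVec {d : ℕ} {K : Set (Fin d → ℝ)} {A : Matrix (Fin d) (Fin d) ℝ}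
    (hA : IsUnit A.det) (hAK : ∀ x ∈ K, A.mulVec x ∈ K) {x : Fin d → ℝ} (hx : x ∈ K)
    (hxe : ¬ IsExtremeVector K x) : ¬ IsExtremeVector K (A.mulVec x) := by
  have hinj : Function.Injective A.mulVec :=
    Matrix.mulVec_injective_iff_isUnit.2 ((Matrix.isUnit_iff_isUnit_det A).2 hA)
  intro h
  refine hxe ⟨fun h0 => h.1 (by simp [h0]), hx, fun u hu w hw huw => ?_⟩
  have key : ∀ {z : Fin d → ℝ}, (∃ s : ℝ, 0 ≤ s ∧ A.mulVec z = s • A.mulVec x) →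
      ∃ s : ℝ, 0 ≤ s ∧ z = s • x := by
    rintro z ⟨s, hs, hz⟩
    exact ⟨s, hs, hinj (by rw [hz, Matrix.mulVec_smul])⟩
  obtain ⟨h₁, h₂⟩ := h.2.2 _ (hAK u hu) _ (hAK w hw) (by rw [huw, Matrix.mulVec_add])
  exact ⟨key h₁, key h₂⟩

theorem IsProperCone.exists_nonneg_pos {d : ℕ} {K : Set (Fin d → ℝ)} (hK : IsProperCone K)
    {x : Fin d → ℝ} (hx : x ∈ K) (hx0 : x ≠ 0) :
    ∃ f : (Fin d → ℝ) →L[ℝ] ℝ, (∀ y ∈ K, 0 ≤ f y) ∧ 0 < f x := by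
  obtain ⟨hcl, hconv, hsmul, hpt, -⟩ := hK
  have hnx : -x ∉ K := fun h => hx0 (by
    have : x ∈ K ∩ -K := ⟨hx, h⟩
    simpa [hpt] using this)
  obtain ⟨f, u, hfx, hf⟩ := geometric_hahn_banach_point_closed hconv hcl hnx
  have hu : u < 0 := by simpa using hf _ (hsmul x hx 0 le_rfl)
  refine ⟨f, fun y hy => ?_, ?_⟩
  · by_contra! hy0
    have := hf _ (hsmul y hy (u / f y) (div_nonneg_of_nonpos hu.le hy0.le))
    rw [map_smul, smul_eq_mul, div_mul_cancel₀ _ hy0.ne] at this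
    exact lt_irrefl _ this
  · rw [map_neg] at hfx
    linarith

theorem IsProperCone.exists_pos {d : ℕ} {K : Set (Fin d → ℝ)} (hK : IsProperCone K) :
    ∃ f : (Fin d → ℝ) →L[ℝ] ℝ, ∀ x ∈ K, x ≠ 0 → 0 < f x := by
  have hcomp : IsCompact (K ∩ Metric.sphere 0 1) := (isCompact_sphere 0 1).inter_left hK.1
  obtain ⟨f, -, hf⟩ : ∃ f : (Fin d → ℝ) →L[ℝ] ℝ, (∀ y ∈ K, 0 ≤ f y) ∧
      ∀ x ∈ K ∩ Metric.sphere 0 1, x ∈ K → 0 < f x := by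
    refine hcomp.induction_on (p := fun s => ∃ f : (Fin d → ℝ) →L[ℝ] ℝ,
      (∀ y ∈ K, 0 ≤ f y) ∧ ∀ x ∈ s, x ∈ K → 0 < f x) ⟨0, by simp, by simp⟩ ?_ ?_ ?_
    · rintro s t hst ⟨f, hf, hft⟩
      exact ⟨f, hf, fun x hx => hft x (hst hx)⟩
    · rintro s t ⟨f, hf, hfs⟩ ⟨g, hg, hgt⟩
      refine ⟨f + g, fun y hy => add_nonneg (hf y hy) (hg y hy), ?_⟩
      rintro x (hx | hx) hxK
      · exact add_pos_of_pos_of_nonneg (hfs x hx hxK) (hg x hxK)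
      · exact add_pos_of_nonneg_of_pos (hf x hxK) (hgt x hx hxK)
    · rintro x ⟨hxK, hx1⟩
      obtain ⟨f, hf, hfx⟩ := hK.exists_nonneg_pos hxK (ne_zero_of_mem_unit_sphere ⟨x, hx1⟩)
      exact ⟨{y | 0 < f y}, mem_nhdsWithin_of_mem_nhds
        ((isOpen_lt continuous_const f.continuous).mem_nhds hfx), f, hf, fun y hy _ => hy⟩
  refine ⟨f, fun x hx hx0 => ?_⟩
  have hn : 0 < ‖x‖ := norm_pos_iff.2 hx0
  have hmem := hK.2.2.1 x hx ‖x‖⁻¹ (by positivity)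
  have := hf (‖x‖⁻¹ • x) ⟨hmem, by simp [norm_smul, hn.ne']⟩ hmem
  rw [map_smul, smul_eq_mul] at this
  exact pos_of_mul_pos_right this (by positivity)

theorem IsProperCone.exists_isExtremeVector {d : ℕ} {K : Set (Fin d → ℝ)} (hK : IsProperCone K)
    {v : Fin d → ℝ} (hv : v ∈ K) (hv0 : v ≠ 0) : ∃ w, IsExtremeVector K w := by
  obtain ⟨f, hf⟩ := hK.exists_pos
  obtain ⟨hcl, hconv, hsmul, -, -⟩ := hK
  have hnorm : ∀ x ∈ K, x ≠ 0 → (f x)⁻¹ • x ∈ K ∩ {x | f x = 1} := fun x hx hx0 =>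
    ⟨hsmul x hx _ (inv_nonneg.2 (hf x hx hx0).le), by
      simp [(hf x hx hx0).ne']⟩
  have hcomp : IsCompact (K ∩ {x | f x = 1}) := by
    have hS : IsCompact (K ∩ Metric.sphere (0 : Fin d → ℝ) 1) :=
      (isCompact_sphere 0 1).inter_left hcl
    have hne : ∀ x ∈ K ∩ Metric.sphere (0 : Fin d → ℝ) 1, x ≠ 0 := fun x hx =>
      ne_zero_of_mem_unit_sphere ⟨x, hx.2⟩
    have himg : IsCompact ((fun x => (f x)⁻¹ • x) '' (K ∩ Metric.sphere (0 : Fin d → ℝ) 1)) :=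
      hS.image_of_continuousOn ((f.continuous.continuousOn.inv₀
        fun x hx => (hf x hx.1 (hne x hx)).ne').smul continuousOn_id)
    refine himg.of_isClosed_subset
      (hcl.inter (isClosed_eq f.continuous continuous_const)) fun x hx => ?_
    have hx1 : f x = 1 := hx.2
    have hx0 : x ≠ 0 := fun h => by simp [h] at hx1
    have hn : 0 < ‖x‖ := norm_pos_iff.2 hx0
    refine ⟨‖x‖⁻¹ • x, ⟨hsmul x hx.1 _ (by positivity), by simp [norm_smul, hn.ne']⟩, ?_⟩
    simp [hx1, smul_smul, hn.ne']
  obtain ⟨w, hw⟩ := hcomp.extremePoints_nonempty ⟨_, hnorm v hv hv0⟩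
  obtain ⟨⟨hwK, hw1⟩, hwe⟩ := mem_extremePoints.1 hw
  have hw1 : f w = 1 := hw1
  refine ⟨w, fun h => by simp [h] at hw1, hwK, fun a ha b hb hab => ?_⟩
  by_cases ha0 : a = 0
  · exact ⟨⟨0, le_rfl, by simp [ha0]⟩, 1, zero_le_one, by simp [hab, ha0]⟩
  by_cases hb0 : b = 0
  · exact ⟨⟨1, zero_le_one, by simp [hab, hb0]⟩, 0, le_rfl, by simp [hb0]⟩
  have hfa := hf a ha ha0
  have hfb := hf b hb hb0
  obtain ⟨h₁, h₂⟩ := hwe _ (hnorm a ha ha0) _ (hnorm b hb hb0)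
    ⟨f a, f b, hfa, hfb, by rw [← map_add, ← hab, hw1], by
      rw [smul_inv_smul₀ hfa.ne', smul_inv_smul₀ hfb.ne', hab]⟩
  exact ⟨⟨f a, hfa.le, by rw [← h₁, smul_inv_smul₀ hfa.ne']⟩,
    f b, hfb.le, by rw [← h₂, smul_inv_smul₀ hfb.ne']⟩

theorem isClosed_setOf_smul_of_isCompact {E : Type*} [NormedAddCommGroup E] [NormedSpace ℝ E]
    {B : Set E} (hB : IsCompact B) (f : E →L[ℝ] ℝ) (hf : ∀ b ∈ B, f b = 1) :
    IsClosed {x | ∃ t : ℝ, 0 ≤ t ∧ ∃ b ∈ B, x = t • b} := by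
  refine IsSeqClosed.isClosed fun x y hx hxy => ?_
  choose t ht b hb hxb using hx
  have hft : ∀ n, f (x n) = t n := fun n => by simp [hxb, hf _ (hb n)]
  have hfy : Filter.Tendsto (fun n => f (x n)) Filter.atTop (nhds (f y)) :=
    (f.continuous.tendsto y).comp hxy
  obtain ⟨c, hc, φ, hφ, hbc⟩ := hB.tendsto_subseq hb
  refine ⟨f y, ge_of_tendsto' hfy fun n => by rw [hft]; exact ht n, c, hc, ?_⟩
  refine tendsto_nhds_unique (hxy.comp hφ.tendsto_atTop) ?_
  refine ((hfy.comp hφ.tendsto_atTop).smul hbc).congr fun n => ?_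
  simp only [Function.comp_apply, hft, ← hxb]

theorem convexHull_smul_mem {E : Type*} [AddCommGroup E] [Module ℝ E] (G : Set E) {x : E}
    (hx : x ∈ convexHull ℝ {x | ∃ g ∈ G, ∃ t : ℝ, 0 ≤ t ∧ x = t • g}) {s : ℝ} (hs : 0 ≤ s) :
    s • x ∈ convexHull ℝ {x | ∃ g ∈ G, ∃ t : ℝ, 0 ≤ t ∧ x = t • g} := by
  refine convexHull_min (t := (s • ·) ⁻¹' _) ?_
    ((convex_convexHull ℝ _).is_linear_preimage (IsLinearMap.isLinearMap_smul s)) hx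
  rintro _ ⟨g, hg, t, ht, rfl⟩
  exact subset_convexHull ℝ _ ⟨g, hg, s * t, by positivity, by rw [mul_smul]⟩

theorem isClosed_convexHull_smul_of_finite {E : Type*} [NormedAddCommGroup E] [NormedSpace ℝ E]
    {G : Set E} (hG : G.Finite) (f : E →L[ℝ] ℝ) (hf : ∀ g ∈ G, 0 < f g) :
    IsClosed (convexHull ℝ {x | ∃ g ∈ G, ∃ t : ℝ, 0 ≤ t ∧ x = t • g}) := by
  set B := convexHull ℝ ((fun g => (f g)⁻¹ • g) '' G)
  have hB : IsCompact B := (hG.image _).isCompact_convexHull ℝ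
  have hmem : ∀ g ∈ G, (f g)⁻¹ • g ∈ B := fun g hg => subset_convexHull ℝ _ ⟨g, hg, rfl⟩
  have hfB : ∀ b ∈ B, f b = 1 := by
    refine fun b hb => convexHull_min (t := {b | f b = 1}) ?_
      (convex_hyperplane f.toLinearMap.isLinear 1) hb
    rintro _ ⟨g, hg, rfl⟩
    simp [(hf g hg).ne']
  convert isClosed_setOf_smul_of_isCompact hB f hfB using 1
  apply subset_antisymm
  · refine convexHull_min ?_ ?_
    · rintro _ ⟨g, hg, t, ht, rfl⟩
      have := hf g hg
      exact ⟨t * f g, by positivity, _, hmem g hg, by rw [mul_smul, smul_inv_smul₀ this.ne']⟩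
    · rintro _ ⟨s, hs, b, hb, rfl⟩ _ ⟨t, ht, c, hc, rfl⟩ p q hp hq hpq
      have hps := mul_nonneg hp hs
      have hqt := mul_nonneg hq ht
      rcases (add_nonneg hps hqt).eq_or_lt with h | h
      · have h₁ : p * s = 0 := by linarith
        have h₂ : q * t = 0 := by linarith
        exact ⟨0, le_rfl, b, hb, by simp [smul_smul, h₁, h₂]⟩
      · refine ⟨p * s + q * t, h.le, _, convex_convexHull ℝ _ hb hc
          (div_nonneg hps h.le) (div_nonneg hqt h.le) (by field_simp), ?_⟩
        rw [smul_add, smul_smul, smul_smul, smul_smul, smul_smul,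
          mul_div_cancel₀ _ h.ne', mul_div_cancel₀ _ h.ne']
  · rintro _ ⟨t, ht, b, hb, rfl⟩
    refine convexHull_smul_mem G (convexHull_mono ?_ hb) ht
    rintro _ ⟨g, hg, rfl⟩
    exact ⟨g, hg, _, inv_nonneg.2 (hf g hg).le, rfl⟩

theorem directAlgCone_eq {d m : ℕ} (𝒜 : Fin m → Matrix (Fin d) (Fin d) ℝ) (v : Fin d → ℝ)
    (j : ℕ) : directAlgCone 𝒜 v j =
      convexHull ℝ {x | ∃ g ∈ (fun l : List (Fin m) => (l.map 𝒜).prod.mulVec v) ''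
        {l | l.length ≤ j}, ∃ t : ℝ, 0 ≤ t ∧ x = t • g} := by
  unfold directAlgCone
  congr 1
  ext x
  simp

theorem mem_directAlgCone_self {d m : ℕ} (𝒜 : Fin m → Matrix (Fin d) (Fin d) ℝ)
    (v : Fin d → ℝ) (j : ℕ) : v ∈ directAlgCone 𝒜 v j :=
  subset_convexHull ℝ _ ⟨[], by simp, 1, zero_le_one, by simp⟩

/-- An irreducible family leaving a cone of the Direct Algorithm invariant makes that cone
full-dimensional. -/
theorem interior_directAlgCone_nonempty {d m : ℕ} {𝒜 : Fin m → Matrix (Fin d) (Fin d) ℝ}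
    (hirr : IsIrreducibleFamily 𝒜) {v : Fin d → ℝ} (hv0 : v ≠ 0) {j : ℕ}
    (hinv : ∀ i, ∀ x ∈ directAlgCone 𝒜 v j, (𝒜 i).mulVec x ∈ directAlgCone 𝒜 v j) :
    (interior (directAlgCone 𝒜 v j)).Nonempty := by
  have hspan : Submodule.span ℝ (directAlgCone 𝒜 v j) = ⊤ := by
    refine (hirr _ fun i x hx => ?_).resolve_left fun h => hv0 ?_
    · exact (Submodule.span_le (p := (Submodule.span ℝ _).comap (𝒜 i).mulVecLin)).2
        (fun y hy => Submodule.subset_span (hinv i y hy)) hx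
    · exact (Submodule.mem_bot ℝ).1 (h ▸ Submodule.subset_span (mem_directAlgCone_self 𝒜 v j))
  have h0 : (0 : Fin d → ℝ) ∈ directAlgCone 𝒜 v j :=
    subset_convexHull ℝ _ ⟨[], by simp, 0, le_rfl, by simp⟩
  rw [(show Convex ℝ (directAlgCone 𝒜 v j) from
    convex_convexHull ℝ _).interior_nonempty_iff_affineSpan_eq_top]
  apply SetLike.coe_injective
  rw [← Set.insert_eq_of_mem h0, affineSpan_insert_zero, hspan]
  rfl

/-- For nonsingular matrices and a non-extreme starting vector `v ∈ K_min`, no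
cone `K_j` of the Direct Algorithm contains an extreme generator of `K_min`;
hence `K_j ≠ K_min` and `K_j` is not invariant. -/
theorem direct_algorithm_never_halts {d m : ℕ} (hm : 0 < m)
    (𝒜 : Fin m → Matrix (Fin d) (Fin d) ℝ)
    (hirr : IsIrreducibleFamily 𝒜)
    (hns : ∀ i, IsUnit (𝒜 i).det)
    (Kmin : Set (Fin d → ℝ)) (hmin : IsMinimalInvariantCone 𝒜 Kmin)
    (v : Fin d → ℝ) (hvK : v ∈ Kmin) (hv0 : v ≠ 0)
    (hvnotext : ¬ IsExtremeVector Kmin v) :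
    ∀ j : ℕ,
      (∀ w : Fin d → ℝ, IsExtremeVector Kmin w → w ∉ directAlgCone 𝒜 v j) ∧
      directAlgCone 𝒜 v j ≠ Kmin ∧
      ¬ (∀ i, ∀ x ∈ directAlgCone 𝒜 v j, (𝒜 i).mulVec x ∈ directAlgCone 𝒜 v j) := by
  obtain ⟨⟨hK, hinvK⟩, hleast⟩ := hmin
  have hKsmul := hK.2.2.1
  have horbit : ∀ l : List (Fin m), (l.map 𝒜).prod.mulVec v ∈ Kmin ∧
      (l.map 𝒜).prod.mulVec v ≠ 0 ∧ ¬ IsExtremeVector Kmin ((l.map 𝒜).prod.mulVec v) := by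
    intro l
    induction l with
    | nil => simpa using ⟨hvK, hv0, hvnotext⟩
    | cons i l ih =>
      have hinj : Function.Injective (𝒜 i).mulVec :=
        Matrix.mulVec_injective_iff_isUnit.2 ((Matrix.isUnit_iff_isUnit_det _).2 (hns i))
      rw [List.map_cons, List.prod_cons, ← Matrix.mulVec_mulVec]
      exact ⟨hinvK i _ ih.1, fun h => ih.2.1 (hinj (by rw [h, Matrix.mulVec_zero])),
        not_isExtremeVector_mulVec (hns i) (hinvK i) ih.1 ih.2.2⟩
  intro j
  have hsub : directAlgCone 𝒜 v j ⊆ {x ∈ Kmin | ¬ IsExtremeVector Kmin x} := by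
    refine convexHull_min ?_ (convex_setOf_not_isExtremeVector hK.2.1 hKsmul)
    rintro _ ⟨l, -, t, ht, rfl⟩
    exact ⟨hKsmul _ (horbit l).1 t ht, fun h =>
      (horbit l).2.2 (h.of_eq_smul hKsmul ht (horbit l).1 rfl)⟩
  have hne : directAlgCone 𝒜 v j ≠ Kmin := by
    intro h
    obtain ⟨w, hw⟩ := hK.exists_isExtremeVector hvK hv0
    exact (hsub (h ▸ hw.2.1)).2 hw
  refine ⟨fun w hw hwj => (hsub hwj).2 hw, hne, fun hinv => ?_⟩
  obtain ⟨f, hf⟩ := hK.exists_pos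
  have hclosed : IsClosed (directAlgCone 𝒜 v j) := by
    rw [directAlgCone_eq]
    refine isClosed_convexHull_smul_of_finite ((List.finite_length_le _ j).image _) f ?_
    rintro _ ⟨l, -, rfl⟩
    exact hf _ (horbit l).1 (horbit l).2.1
  have hsmul : ∀ x ∈ directAlgCone 𝒜 v j, ∀ t : ℝ, 0 ≤ t → t • x ∈ directAlgCone 𝒜 v j := by
    rw [directAlgCone_eq]
    exact fun x hx t ht => convexHull_smul_mem _ hx ht
  have h0 : (0 : Fin d → ℝ) ∈ directAlgCone 𝒜 v j := by
    simpa using hsmul v (mem_directAlgCone_self 𝒜 v j) 0 le_rfl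
  have hpointed : directAlgCone 𝒜 v j ∩ -directAlgCone 𝒜 v j = {0} := by
    refine subset_antisymm (fun x hx => ?_) (by simpa using h0)
    rw [← hK.2.2.2.1]
    exact ⟨(hsub hx.1).1, (hsub hx.2).1⟩
  rcases hleast _ ⟨⟨hclosed, convex_convexHull ℝ _, hsmul, hpointed,
    interior_directAlgCone_nonempty hirr hv0 hinv⟩, hinv⟩ with h | h
  · exact hne (subset_antisymm (fun x hx => (hsub hx).1) h)
  · have : v ∈ Kmin ∩ -Kmin := ⟨hvK, (hsub (h hvK)).1⟩
    rw [hK.2.2.2.1] at this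
    exact hv0 this
end
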